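/- For every Delta^0_2-computable real alpha in [0,1], the class DIM^{<=alpha} = {X : dim(X) <= alpha} is a Pi^0_2 class, and the class DIM^{>=alpha} = {X : dim(X) >= alpha} is a Pi^0_3 class; consequently DIM^alpha = {X : dim(X) = alpha} is Pi^0_3, and DIM^0 is Pi^0_2. -/

import Mathlib

open Filter Topology

abbrev Cantor := ℕ → Bool

/-- The length-`n` prefix of an infinite binary sequence, as a list. -/
def pref (X : ℕ → Bool) (n : ℕ) : List Bool := (List.range n).map X

/-- A predicate is computably enumerable (c.e., Σ⁰₁). -/
def CEPred {α : Type} [Primcodable α] (P : α → Prop) : Prop :=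
  ∃ f : α →. Unit, Partrec f ∧ ∀ a, P a ↔ (f a).Dom

/-- A predicate (of the outer quantified numbers together with a finite prefix
of the sequence) is Δ⁰₁, i.e. computable. -/
def DeltaPred (P : List ℕ → List Bool → Prop) : Prop :=
  ComputablePred fun p : List ℕ × List Bool => P p.1 p.2

/-- A predicate is Π⁰₁, i.e. co-computably enumerable. -/
def PiPred (P : List ℕ → List Bool → Prop) : Prop :=
  CEPred fun p : List ℕ × List Bool => ¬ P p.1 p.2

/-- `AltQ n b P ks A`: `n` alternating quantifiers (starting with `∃` if `b`,
with `∀` otherwise) applied to the predicate `P`, where the innermost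
quantified variable is the length of the prefix of `A` handed to `P`, and `ks`
accumulates the previously quantified numbers. -/
def AltQ : ℕ → Bool → (List ℕ → List Bool → Prop) → List ℕ → Cantor → Prop
  | 0, _, P, ks, _ => P ks []
  | 1, true, P, ks, A => ∃ k, P ks (pref A k)
  | 1, false, P, ks, A => ∀ k, P ks (pref A k)
  | n+2, true, P, ks, A => ∃ k, AltQ (n+1) false P (ks ++ [k]) A
  | n+2, false, P, ks, A => ∀ k, AltQ (n+1) true P (ks ++ [k]) A

/-- `X ∈ Σ⁰ₙ[C]`: definable with `n` alternating quantifiers starting with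
`∃`, over some predicate in the class `C`. -/
def SigmaIn (n : ℕ) (C : (List ℕ → List Bool → Prop) → Prop) (X : Set Cantor) : Prop :=
  ∃ P, C P ∧ ∀ A : Cantor, A ∈ X ↔ AltQ n true P [] A

/-- `X ∈ Π⁰ₙ[C]`: definable with `n` alternating quantifiers starting with
`∀`, over some predicate in the class `C`. -/
def PiIn (n : ℕ) (C : (List ℕ → List Bool → Prop) → Prop) (X : Set Cantor) : Prop :=
  ∃ P, C P ∧ ∀ A : Cantor, A ∈ X ↔ AltQ n false P [] A

/-- A prefix-free machine: a partial computable map from programs (finite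
binary strings) to strings, whose domain is an antichain under the prefix
relation. -/
def PFMachine (M : List Bool →. List Bool) : Prop :=
  Partrec M ∧ ∀ p q : List Bool, (M p).Dom → (M q).Dom → p <+: q → p = q

/-- A universal prefix-free machine: a prefix-free machine simulating every
prefix-free machine with only a constant overhead in program length. -/
def UniversalPF (U : List Bool →. List Bool) : Prop :=
  PFMachine U ∧ ∀ M : List Bool →. List Bool, PFMachine M → ∃ c : ℕ,
    ∀ w p : List Bool, w ∈ M p → ∃ q : List Bool, w ∈ U q ∧ q.length ≤ p.length + c

/-- Prefix-free Kolmogorov complexity with respect to the machine `U`: the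
length of a shortest program producing `w`. -/
noncomputable def K (U : List Bool →. List Bool) (w : List Bool) : ℕ :=
  sInf {n : ℕ | ∃ p : List Bool, w ∈ U p ∧ p.length = n}

/-- `dimK U X = liminf_n K(X↾n)/n`, the (Kolmogorov characterization of the)
constructive dimension of the sequence `X`. -/
noncomputable def dimK (U : List Bool →. List Bool) (X : Cantor) : ℝ :=
  Filter.liminf (fun n : ℕ => (K U (pref X n) : ℝ) / n) Filter.atTop

/-- `DimK U X = limsup_n K(X↾n)/n`, the (Kolmogorov characterization of the)
constructive strong dimension of the sequence `X`. -/
noncomputable def DimK (U : List Bool →. List Bool) (X : Cantor) : ℝ :=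
  Filter.limsup (fun n : ℕ => (K U (pref X n) : ℝ) / n) Filter.atTop

/-- The code of a rational in the `Encodable` instance. -/
def ratE (q : ℚ) : ℕ := @Encodable.encode ℚ Rat.instEncodable q

/-- The code of a rational in the `Denumerable` instance. -/
def ratD (q : ℚ) : ℕ := @Encodable.encode ℚ Rat.instDenumerable.toEncodable q

theorem ratE_eq (q : ℚ) : ratE q = Nat.pair (Encodable.encode q.num) q.den := by
  cases q; rfl

theorem encode_int (z : ℤ) : Encodable.encode z = if 0 ≤ z then 2 * z.toNat else 2 * (-z).toNat - 1 := by
  cases z with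
  | ofNat n => 
    have : Encodable.encode (Int.ofNat n) = 2 * n := rfl
    rw [this]; simp
  | negSucc n =>
    have : Encodable.encode (Int.negSucc n) = 2 * n + 1 := rfl
    rw [this]; 
    have h : ¬ (0 ≤ Int.negSucc n) := by omega
    rw [if_neg h]
    omega

theorem mem_range_ratE (y : ℕ) : y ∈ Set.range ratE ↔
    0 < y.unpair.2 ∧ Nat.Coprime ((y.unpair.1 + 1) / 2) y.unpair.2 := by
  constructor
  · rintro ⟨q, rfl⟩
    rw [ratE_eq]
    simp only [Nat.unpair_pair]
    refine ⟨q.pos, ?_⟩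
    have h : (Encodable.encode q.num + 1) / 2 = q.num.natAbs := by
      rw [encode_int]; split_ifs <;> omega
    rw [h]; exact q.reduced
  · rintro ⟨h1, h2⟩
    obtain ⟨z, hz⟩ : ∃ z : ℤ, Encodable.encode z = y.unpair.1 :=
      ⟨Equiv.intEquivNat.symm y.unpair.1, Equiv.apply_symm_apply Equiv.intEquivNat _⟩
    have h : (Encodable.encode z + 1) / 2 = z.natAbs := by
      rw [encode_int]; split_ifs <;> omega
    refine ⟨⟨z, y.unpair.2, h1.ne', ?_⟩, ?_⟩
    · rw [← h, hz]; exact h2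
    · rw [ratE_eq]; simp [hz]

theorem ratE_infinite : Infinite (Set.range ratE) := 
  Infinite.of_injective _ (Equiv.ofInjective _ (@Encodable.encode_injective ℚ Rat.instEncodable)).injective

theorem ratE_ofNat : ∃ (g : ℕ → ℕ) (_ : ∀ q : ℚ, g (ratD q) = ratE q) ,
   (∀ n, g n ∈ Set.range ratE) ∧ (∀ n x, x ∈ Set.range ratE → g n < x → g (n+1) ≤ x) ∧ (∀ n, g n < g (n+1)) := by
  let : DecidablePred (· ∈ Set.range ratE) := @Encodable.decidableRangeEncode ℚ _
  let := ratE_infinite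
  refine ⟨fun n => (Nat.Subtype.ofNat (Set.range ratE) n : ℕ), ?_, ?_, ?_, ?_⟩
  · intro q
    obtain ⟨n, rfl⟩ : ∃ n, q = Denumerable.ofNat ℚ n := ⟨ratD q, (Denumerable.ofNat_encode q).symm⟩
    have hD : ratD (Denumerable.ofNat ℚ n) = n := Denumerable.encode_ofNat n
    rw [hD]
    exact congrArg Subtype.val ((Equiv.symm_apply_eq (Encodable.equivRangeEncode ℚ)
      (y := Denumerable.ofNat ℚ n) (x := Nat.Subtype.ofNat (Set.range ratE) n)).1 rfl)
  · intro n; exact Subtype.property _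
  · intro n x hx h
    exact Nat.Subtype.succ_le_of_lt (x := ⟨x, hx⟩) h
  · intro n
    exact Nat.Subtype.lt_succ_self (Nat.Subtype.ofNat (Set.range ratE) n)

theorem primrec_mem_range : PrimrecPred (fun y => y ∈ Set.range ratE) := by
  have h1 : PrimrecRel fun (k : ℕ) (y : ℕ) => (((y.unpair.1 + 1) / 2) % k = 0 ∧ y.unpair.2 % k = 0) → k = 1 := by
    have a1 : Primrec fun p : ℕ × ℕ => ((p.2.unpair.1 + 1) / 2) % p.1 :=
      Primrec.nat_mod.comp (Primrec.nat_div.comp (Primrec.succ.comp (Primrec.fst.comp (Primrec.unpair.comp Primrec.snd))) (Primrec.const 2)) Primrec.fst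
    have a2 : Primrec fun p : ℕ × ℕ => p.2.unpair.2 % p.1 :=
      Primrec.nat_mod.comp (Primrec.snd.comp (Primrec.unpair.comp Primrec.snd)) Primrec.fst
    have b1 := Primrec.eq.comp a1 (Primrec.const 0)
    have b2 := Primrec.eq.comp a2 (Primrec.const 0)
    have b3 := Primrec.eq.comp (Primrec.fst (α := ℕ) (β := ℕ)) (Primrec.const 1)
    refine PrimrecPred.of_eq ((b1.and b2).not.or b3) ?_
    intro p; tauto
  have h2 : PrimrecPred fun y : ℕ => ∀ k < y.unpair.2 + 1, (((y.unpair.1 + 1) / 2) % k = 0 ∧ y.unpair.2 % k = 0) → k = 1 :=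
    h1.forall_lt.comp (Primrec.succ.comp (Primrec.snd.comp Primrec.unpair)) Primrec.id
  have h3 : PrimrecPred fun y : ℕ => 0 < y.unpair.2 :=
    Primrec.nat_lt.comp (Primrec.const 0) (Primrec.snd.comp Primrec.unpair)
  refine (h3.and h2).of_eq fun y => ?_
  rw [mem_range_ratE]
  refine and_congr_right fun hy => ⟨fun h => ?_, fun h => ?_⟩
  · refine h _ (Nat.lt_succ_of_le (Nat.gcd_le_right _ hy)) ⟨?_, ?_⟩
    · exact Nat.mod_eq_zero_of_dvd (Nat.gcd_dvd_left _ _)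
    · exact Nat.mod_eq_zero_of_dvd (Nat.gcd_dvd_right _ _)
  · rintro k - ⟨h1, h2⟩
    exact Nat.eq_one_of_dvd_coprimes h (Nat.dvd_of_mod_eq_zero h1) (Nat.dvd_of_mod_eq_zero h2)

theorem ratE_computable : ∃ g : ℕ → ℕ, Computable g ∧ ∀ q : ℚ, g (ratD q) = ratE q := by
  classical
  obtain ⟨g, h1, h2, h3, h4⟩ := ratE_ofNat
  refine ⟨g, ?_, h1⟩
  have hp : Computable fun y => decide (y ∈ Set.range ratE) := by
    exact (primrec_mem_range.decide).to_comp
  have hinf : ∀ x, ∃ m, x + m + 1 ∈ Set.range ratE := by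
    intro x
    have hm : StrictMono g := strictMono_nat_of_lt_succ h4
    have := hm.le_apply (x := x+1)
    exact ⟨g (x+1) - (x+1), by convert h2 (x+1) using 1; omega⟩
  let nx : ℕ → ℕ := fun x => Nat.find (hinf x)
  have hnx : Computable nx := by
    have : Partrec fun x : ℕ => Nat.rfind fun m => (Part.some (decide (x + m + 1 ∈ Set.range ratE))) := by
      apply Partrec.rfind
      have : Computable fun p : ℕ × ℕ => p.1 + p.2 + 1 := (Primrec.succ.comp Primrec.nat_add).to_comp
      exact (hp.comp this)
    refine this.of_eq fun x => ?_
    refine Part.eq_some_iff.2 (Nat.mem_rfind.2 ?_)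
    constructor
    · have := Nat.find_spec (hinf x)
      exact Part.mem_some_iff.2 (decide_eq_true this).symm
    · intro m hm
      have := Nat.find_min (hinf x) hm
      exact Part.mem_some_iff.2 (decide_eq_false this).symm
  have hrec : ∀ n, g (n+1) = g n + nx (g n) + 1 := by
    intro n
    apply le_antisymm
    · exact h3 _ _ (Nat.find_spec (hinf (g n))) (by omega)
    · have : nx (g n) ≤ g (n+1) - (g n + 1) := Nat.find_min' _ (by convert h2 (n+1) using 1; have := h4 n; omega)
      have := h4 n; omega
  have hc : Computable fun n : ℕ => (Nat.rec (g 0) (fun _ y => y + nx y + 1) n : ℕ) := by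
    refine Computable.nat_rec (f := fun n : ℕ => n) (g := fun _ => g 0) (h := fun _ p => p.2 + nx p.2 + 1) Computable.id (Computable.const _) ?_
    have hy : Computable fun p : ℕ × ℕ × ℕ => p.2.2 := (Primrec.snd.comp Primrec.snd).to_comp
    exact Computable.succ.comp (Primrec.nat_add.to_comp.comp hy (hnx.comp hy))
  refine hc.of_eq fun n => ?_
  induction n with
  | zero => rfl
  | succ n ih => rw [hrec, ← ih]

theorem exists_num_den (α : ℝ) (hα : 0 ≤ α) (a : ℕ → ℚ) (ha : Computable a)
    (hlim : Filter.Tendsto (fun n => (a n : ℝ)) Filter.atTop (nhds α)) :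
    ∃ num den : ℕ → ℕ, Computable num ∧ Computable den ∧ (∀ n, 0 < den n) ∧
      Filter.Tendsto (fun n => (num n : ℝ) / den n) Filter.atTop (nhds α) := by
  obtain ⟨g, hg, hgq⟩ := ratE_computable
  have hE : Computable fun n => ratE (a n) :=
    (hg.comp (Computable.encode.comp ha)).of_eq fun n => hgq _
  have hden : Computable fun n => (a n).den :=
    ((Primrec.snd.comp Primrec.unpair).to_comp.comp hE).of_eq fun n => by
      simp [ratE_eq]
  have hpr : Primrec fun y : ℕ => if y.unpair.1 % 2 = 0 then y.unpair.1 / 2 else 0 := by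
    have h1 : Primrec fun y : ℕ => y.unpair.1 := Primrec.fst.comp Primrec.unpair
    exact Primrec.ite (Primrec.eq.comp (Primrec.nat_mod.comp h1 (Primrec.const 2)) (Primrec.const 0))
      (Primrec.nat_div.comp h1 (Primrec.const 2)) (Primrec.const 0)
  have hnum : Computable fun n => (a n).num.toNat :=
    (hpr.to_comp.comp hE).of_eq fun n => by
      simp only [ratE_eq, Nat.unpair_pair, encode_int]
      split_ifs <;> omega
  refine ⟨_, _, hnum, hden, fun n => (a n).pos, ?_⟩
  have h2 : Tendsto (fun n => max (a n : ℝ) 0) atTop (nhds α) := by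
    have := hlim.max (tendsto_const_nhds (x := (0:ℝ)))
    rwa [max_eq_left hα] at this
  refine h2.congr fun n => ?_
  have hd : (0:ℝ) < (a n).den := by exact_mod_cast (a n).pos
  have e : ((a n : ℚ) : ℝ) = ((a n).num : ℝ) / (a n).den := Rat.cast_def _
  rw [eq_div_iff hd.ne', max_mul_of_nonneg _ _ hd.le, e, div_mul_cancel₀ _ hd.ne', zero_mul]
  have : (((a n).num.toNat : ℤ)) = max (a n).num 0 := Int.toNat_eq_max _
  exact_mod_cast this.symm

/-- Self-delimiting code of a string. -/
def selfDel (w : List Bool) : List Bool := w.flatMap (fun b => [true, b]) ++ [false]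

theorem selfDel_prefix : ∀ v w : List Bool, selfDel v <+: selfDel w → v = w
  | [], [], _ => rfl
  | [], b :: w, h => by simp [selfDel, List.cons_prefix_cons] at h
  | b :: v, [], h => by simp [selfDel, List.cons_prefix_cons] at h
  | b :: v, c :: w, h => by
    have h' : b = c ∧ selfDel v <+: selfDel w := by
      simpa [selfDel, List.cons_prefix_cons] using h
    rw [h'.1, selfDel_prefix v w h'.2]

theorem selfDel_length (w : List Bool) : (selfDel w).length = 2 * w.length + 1 := by
  induction w with
  | nil => rfl
  | cons b w ih =>
    have : selfDel (b :: w) = true :: b :: selfDel w := by simp [selfDel]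
    rw [this]; simp [ih]; ring

theorem selfDel_primrec : Primrec selfDel := by
  have h : Primrec₂ fun (_ : List Bool) (b : Bool) => [true, b] :=
    Primrec.list_cons.comp (Primrec.const true)
      (Primrec.list_cons.comp Primrec.snd (Primrec.const []))
  exact Primrec.list_append.comp (Primrec.list_flatMap Primrec.id h) (Primrec.const [false])

/-- Search step of the decoder. -/
def decStep (p : List Bool) (n : ℕ) : Option (List Bool) :=
  (Encodable.decode (α := List Bool) n).bind fun w => if selfDel w = p then some w else none

theorem decStep_mem {p : List Bool} {n : ℕ} {w : List Bool} (h : w ∈ decStep p n) :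
    selfDel w = p := by
  simp only [decStep, Option.mem_def, Option.bind_eq_some_iff] at h
  obtain ⟨v, -, hv⟩ := h
  split_ifs at hv with h1
  · cases hv; exact h1

theorem decStep_computable : Computable₂ decStep := by
  have h1 : Primrec fun x : List Bool × ℕ => (Encodable.decode (α := List Bool) x.2) :=
    Primrec.decode.comp Primrec.snd
  have h2 : Primrec₂ fun (x : List Bool × ℕ) (w : List Bool) =>
      if selfDel w = x.1 then some w else none := by
    refine Primrec.ite (Primrec.eq.comp (selfDel_primrec.comp Primrec.snd)
      (Primrec.fst.comp Primrec.fst)) (Primrec.option_some.comp Primrec.snd) (Primrec.const none)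
  exact (Primrec.option_bind h1 h2).to_comp

/-- The decoder machine. -/
def decM (p : List Bool) : Part (List Bool) := Nat.rfindOpt (decStep p)

theorem decM_mem (w p : List Bool) : w ∈ decM p ↔ selfDel w = p := by
  constructor
  · intro h
    obtain ⟨n, hn⟩ := Nat.rfindOpt_spec h
    exact decStep_mem hn
  · intro h
    have hd : (decM p).Dom := by
      refine Nat.rfindOpt_dom.2 ⟨Encodable.encode w, w, ?_⟩
      simp [decStep, h]
    obtain ⟨v, hv⟩ := Part.dom_iff_mem.1 hd
    obtain ⟨n, hn⟩ := Nat.rfindOpt_spec hv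
    have := decStep_mem hn
    have : v = w := selfDel_prefix _ _ (by rw [this, h])
    exact this ▸ hv

theorem decM_PF : PFMachine decM := by
  refine ⟨Partrec.rfindOpt decStep_computable, fun p q hp hq hpq => ?_⟩
  obtain ⟨v, hv⟩ := Part.dom_iff_mem.1 hp
  obtain ⟨w, hw⟩ := Part.dom_iff_mem.1 hq
  rw [decM_mem] at hv hw
  subst hv hw
  rw [selfDel_prefix _ _ hpq]

theorem K_bound (U : List Bool →. List Bool) (hU : UniversalPF U) :
    ∃ c : ℕ, ∀ w, (∃ p, w ∈ U p ∧ p.length = K U w) ∧ K U w ≤ 2 * w.length + c := by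
  obtain ⟨c, hc⟩ := hU.2 decM decM_PF
  refine ⟨1 + c, fun w => ?_⟩
  obtain ⟨q, hq, hl⟩ := hc w (selfDel w) ((decM_mem _ _).2 rfl)
  refine ⟨Nat.sInf_mem (s := {n : ℕ | ∃ p : List Bool, w ∈ U p ∧ p.length = n}) ⟨_, q, hq, rfl⟩, ?_⟩
  have : K U w ≤ q.length := Nat.sInf_le ⟨q, hq, rfl⟩
  rw [selfDel_length] at hl
  omega

theorem K_le (U : List Bool →. List Bool) {w p : List Bool} (h : w ∈ U p) : K U w ≤ p.length :=
  Nat.sInf_le ⟨p, h, rfl⟩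

theorem exists_halt (U : List Bool →. List Bool) (hU : Partrec U) :
    ∃ h : ℕ × List Bool × ℕ → Bool, Computable h ∧
      ∀ l w, (∃ p, w ∈ U p ∧ p.length = l) ↔ ∃ t, h (l, w, t) = true := by
  obtain ⟨c, hc⟩ := Nat.Partrec.Code.exists_code.1 hU
  refine ⟨fun x => decide (((Encodable.decode (α := List Bool) x.2.2.unpair.1).map List.length) = some x.1) &&
    decide (Nat.Partrec.Code.evaln x.2.2.unpair.2 c x.2.2.unpair.1 = some (Encodable.encode x.2.1)), ?_, ?_⟩
  · have ht : Primrec fun x : ℕ × List Bool × ℕ => x.2.2.unpair := Primrec.unpair.comp (Primrec.snd.comp Primrec.snd)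
    have h1 : Primrec fun x : ℕ × List Bool × ℕ =>
        ((Encodable.decode (α := List Bool) x.2.2.unpair.1).map List.length) :=
      Primrec.option_map (Primrec.decode.comp (Primrec.fst.comp ht))
        (Primrec.list_length.comp Primrec.snd)
    have h2 : Primrec fun x : ℕ × List Bool × ℕ =>
        Nat.Partrec.Code.evaln x.2.2.unpair.2 c x.2.2.unpair.1 :=
      Nat.Partrec.Code.primrec_evaln.comp
        (((Primrec.snd.comp ht).pair (Primrec.const c)).pair (Primrec.fst.comp ht))
    refine (Primrec.and.comp (Primrec.eq.comp h1 (Primrec.option_some.comp Primrec.fst)).decide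
      (Primrec.eq.comp h2 (Primrec.option_some.comp
        (Primrec.encode.comp (Primrec.fst.comp Primrec.snd)))).decide).to_comp
  · intro l w
    simp only [Bool.and_eq_true, decide_eq_true_eq]
    constructor
    · rintro ⟨p, hp, rfl⟩
      have : Encodable.encode w ∈ c.eval (Encodable.encode p) := by
        rw [hc]; simpa using hp
      obtain ⟨k, hk⟩ := Nat.Partrec.Code.evaln_complete.1 this
      exact ⟨Nat.pair (Encodable.encode p) k, by simp, by simpa using hk⟩
    · rintro ⟨t, h1, h2⟩
      rw [Option.map_eq_some_iff] at h1
      obtain ⟨p, hp, hl⟩ := h1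
      refine ⟨p, ?_, hl⟩
      have : Encodable.encode w ∈ c.eval t.unpair.1 :=
        Nat.Partrec.Code.evaln_complete.2 ⟨_, h2⟩
      rw [hc] at this
      simpa [hp] using this

theorem pref_length (X : Cantor) (n : ℕ) : (pref X n).length = n := by simp [pref]

theorem pref_take (X : Cantor) {n k : ℕ} (h : n ≤ k) : (pref X k).take n = pref X n := by
  simp [pref, ← List.map_take, List.take_range, h]

theorem DeltaPred_of (F : List ℕ × List Bool → Bool) (hF : Computable F) :
    DeltaPred fun ks w => F (ks, w) = true :=
  ⟨inferInstance, hF.of_eq fun x => by simp⟩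

theorem DeltaPred.exists_bool {P : List ℕ → List Bool → Prop} (h : DeltaPred P) :
    ∃ p : List ℕ × List Bool → Bool, Computable p ∧ ∀ ks w, p (ks, w) = true ↔ P ks w := by
  obtain ⟨d, c⟩ := h
  exact ⟨_, c, fun ks w => by simp⟩

theorem PiIn_inter {A B : Set Cantor} (hA : PiIn 2 DeltaPred A) (hB : PiIn 3 DeltaPred B) :
    PiIn 3 DeltaPred (A ∩ B) := by
  obtain ⟨P, hdP, hP⟩ := hA
  obtain ⟨Q, hdQ, hQ⟩ := hB
  obtain ⟨p, cP, hp⟩ := hdP.exists_bool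
  obtain ⟨q, cQ, hq⟩ := hdQ.exists_bool
  let F : List ℕ × List Bool → Bool := fun x =>
    cond (decide (x.1.getD 0 0 % 2 = 0)) (q ([x.1.getD 0 0 / 2, x.1.getD 1 0], x.2))
      (decide (x.2.length < x.1.getD 1 0) || p ([x.1.getD 0 0 / 2], x.2.take (x.1.getD 1 0)))
  have hF : Computable F := by
    have g0 : Primrec fun x : List ℕ × List Bool => x.1.getD 0 0 :=
      (Primrec.list_getD 0).comp Primrec.fst (Primrec.const 0)
    have g1 : Primrec fun x : List ℕ × List Bool => x.1.getD 1 0 :=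
      (Primrec.list_getD 0).comp Primrec.fst (Primrec.const 1)
    have d0 : Primrec fun x : List ℕ × List Bool => x.1.getD 0 0 / 2 :=
      Primrec.nat_div.comp g0 (Primrec.const 2)
    have e0 := (Primrec.eq.comp (Primrec.nat_mod.comp g0 (Primrec.const 2)) (Primrec.const 0)).decide
    have e1 := (Primrec.nat_lt.comp (Primrec.list_length.comp (Primrec.snd (α := List ℕ) (β := List Bool))) g1).decide
    have c1 : Computable fun x : List ℕ × List Bool => q ([x.1.getD 0 0 / 2, x.1.getD 1 0], x.2) :=
      cQ.comp ((Primrec.list_cons.comp d0 (Primrec.list_cons.comp g1 (Primrec.const []))).pair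
        Primrec.snd).to_comp
    have c2 : Computable fun x : List ℕ × List Bool =>
        p ([x.1.getD 0 0 / 2], x.2.take (x.1.getD 1 0)) :=
      cP.comp ((Primrec.list_cons.comp d0 (Primrec.const [])).pair
        (Primrec.list_take.comp g1 Primrec.snd)).to_comp
    exact Computable.cond e0.to_comp c1 (Primrec.or.to_comp.comp e1.to_comp c2)
  refine ⟨fun ks w => F (ks, w) = true, DeltaPred_of F hF, fun X => ?_⟩
  have hA := hP X
  have hB := hQ X
  simp only [AltQ, List.nil_append, List.cons_append] at hA hB ⊢
  rw [Set.mem_inter_iff, hA, hB]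
  have key : ∀ j N w, F ([j, N], w) = true ↔
      if j % 2 = 0 then Q [j / 2, N] w else (w.length < N ∨ P [j / 2] (w.take N)) := by
    intro j N w
    by_cases hj : j % 2 = 0 <;> simp [F, hj, hp, hq]
  simp only [key]
  constructor
  · rintro ⟨h1, h2⟩ j
    by_cases hj : j % 2 = 0
    · simpa [hj] using h2 (j / 2)
    · obtain ⟨N, hN⟩ := h1 (j / 2)
      refine ⟨N, fun k => ?_⟩
      rw [if_neg hj, pref_length]
      rcases lt_or_ge k N with h | h
      · exact Or.inl h
      · right; rwa [pref_take X h]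
  · intro h
    constructor
    · intro m
      obtain ⟨N, hN⟩ := h (2 * m + 1)
      have := hN N
      rw [if_neg (by omega), pref_length, pref_take X le_rfl, show (2 * m + 1) / 2 = m by omega] at this
      exact ⟨N, this.resolve_left (lt_irrefl _)⟩
    · intro m
      obtain ⟨N, hN⟩ := h (2 * m)
      refine ⟨N, fun k => ?_⟩
      have := hN k
      rwa [if_pos (by omega), show (2 * m) / 2 = m by omega] at this

section analysis

variable {f : ℕ → ℝ} {C α : ℝ} {b : ℕ → ℝ}

theorem liminf_le_char (h0 : ∀ n, 0 ≤ f n) (hC : ∀ n, f n ≤ C) (hb : Tendsto b atTop (𝓝 α)) :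
    liminf f atTop ≤ α ↔ ∀ m : ℕ, ∃ n s, m < n ∧ m ≤ s ∧ f n < b s + 1 / ((m:ℝ) + 1) := by
  have hbd : IsBoundedUnder (· ≥ ·) atTop f := isBoundedUnder_of ⟨0, h0⟩
  have hcb : IsCoboundedUnder (· ≥ ·) atTop f :=
    (isBoundedUnder_of ⟨C, hC⟩ : IsBoundedUnder (· ≤ ·) atTop f).isCoboundedUnder_ge
  constructor
  · intro h m
    have hm : (0:ℝ) < 1 / ((m:ℝ) + 1) := by positivity
    have h1 : ∃ᶠ n in atTop, f n < α + 1 / ((m:ℝ) + 1) / 2 :=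
      frequently_lt_of_liminf_lt hcb (by linarith)
    obtain ⟨n, hn, hfn⟩ := (frequently_atTop.1 h1) (m + 1)
    have h2 : ∀ᶠ s in atTop, α - 1 / ((m:ℝ) + 1) / 2 < b s := hb.eventually (lt_mem_nhds (by linarith))
    obtain ⟨s, hs, hs'⟩ := (h2.and (eventually_ge_atTop m)).exists
    exact ⟨n, s, hn, hs', by linarith⟩
  · intro h
    refine le_of_forall_pos_lt_add fun ε hε => ?_
    have h2 : ∀ᶠ s in atTop, b s < α + ε / 3 := hb.eventually (gt_mem_nhds (by linarith))
    obtain ⟨S, hS⟩ := eventually_atTop.1 h2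
    obtain ⟨M, hM⟩ := exists_nat_one_div_lt (show (0:ℝ) < ε / 3 by linarith)
    have : liminf f atTop ≤ α + 2 * ε / 3 := by
      refine liminf_le_of_frequently_le ?_ hbd
      rw [frequently_atTop]
      intro N
      obtain ⟨n, s, hn, hs, hf⟩ := h (max N (max S M))
      have hsS := hS s (by omega)
      have : 1 / (((max N (max S M) : ℕ) : ℝ) + 1) ≤ 1 / ((M:ℝ) + 1) :=
        Nat.one_div_le_one_div (by omega)
      exact ⟨n, by omega, by linarith⟩
    linarith

theorem le_liminf_char (h0 : ∀ n, 0 ≤ f n) (hC : ∀ n, f n ≤ C) (hb : Tendsto b atTop (𝓝 α)) :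
    α ≤ liminf f atTop ↔ ∀ m : ℕ, ∃ N : ℕ, ∀ n s, N < n → N ≤ s → b s - 1 / ((m:ℝ) + 1) ≤ f n := by
  have hbd : IsBoundedUnder (· ≥ ·) atTop f := isBoundedUnder_of ⟨0, h0⟩
  have hcb : IsCoboundedUnder (· ≥ ·) atTop f :=
    (isBoundedUnder_of ⟨C, hC⟩ : IsBoundedUnder (· ≤ ·) atTop f).isCoboundedUnder_ge
  constructor
  · intro h m
    have hm : (0:ℝ) < 1 / ((m:ℝ) + 1) := by positivity
    have h1 : ∀ᶠ n in atTop, α - 1 / ((m:ℝ) + 1) / 2 < f n :=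
      eventually_lt_of_lt_liminf (by linarith) hbd
    have h2 : ∀ᶠ s in atTop, b s < α + 1 / ((m:ℝ) + 1) / 2 := hb.eventually (gt_mem_nhds (by linarith))
    obtain ⟨N1, hN1⟩ := eventually_atTop.1 h1
    obtain ⟨N2, hN2⟩ := eventually_atTop.1 h2
    refine ⟨max N1 N2, fun n s hn hs => ?_⟩
    have := hN1 n (by omega)
    have := hN2 s (by omega)
    linarith
  · intro h
    refine le_of_forall_pos_le_add fun ε hε => ?_
    obtain ⟨M, hM⟩ := exists_nat_one_div_lt hε
    obtain ⟨N, hN⟩ := h M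
    have : α - 1 / ((M:ℝ) + 1) ≤ liminf f atTop := by
      refine le_liminf_of_le hcb ?_
      filter_upwards [eventually_gt_atTop N] with n hn
      refine le_of_tendsto (hb.sub_const _) ?_
      filter_upwards [eventually_ge_atTop N] with s hs
      exact hN n s hn hs
    linarith

end analysis

theorem ratio_bound (U : List Bool →. List Bool) (hU : UniversalPF U) (X : Cantor) :
    ∃ C : ℝ, ∀ n : ℕ, (K U (pref X n) : ℝ) / n ≤ C := by
  obtain ⟨c, hc⟩ := K_bound U hU
  refine ⟨2 + c, fun n => ?_⟩
  rcases Nat.eq_zero_or_pos n with rfl | hn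
  · simp; positivity
  · have h1 := (hc (pref X n)).2
    rw [pref_length] at h1
    have hn' : (0:ℝ) < n := by exact_mod_cast hn
    rw [div_le_iff₀ hn']
    have h2 : 2 * n + c ≤ (2 + c) * n := by nlinarith
    exact_mod_cast h1.trans h2

theorem ratio_nonneg (U : List Bool →. List Bool) (X : Cantor) (n : ℕ) :
    (0:ℝ) ≤ (K U (pref X n) : ℝ) / n := by positivity

theorem cmp_lt (l m n nu d : ℕ) (hn : 0 < n) (hd : 0 < d) :
    (l:ℝ) / n < (nu:ℝ) / d + 1 / ((m:ℝ) + 1) ↔ l * (m + 1) * d < (nu * (m + 1) + d) * n := by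
  have hn' : (0:ℝ) < n := by exact_mod_cast hn
  have hd' : (0:ℝ) < d := by exact_mod_cast hd
  have hm' : (0:ℝ) < (m:ℝ) + 1 := by positivity
  rw [div_add_div _ _ hd'.ne' hm'.ne', div_lt_div_iff₀ hn' (by positivity), ← Nat.cast_lt (α := ℝ)]
  push_cast
  constructor <;> intro h <;> linarith

theorem cmp_le (l m n nu d : ℕ) (hn : 0 < n) (hd : 0 < d) :
    (nu:ℝ) / d - 1 / ((m:ℝ) + 1) ≤ (l:ℝ) / n ↔ nu * (m + 1) * n ≤ l * (m + 1) * d + d * n := by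
  have hn' : (0:ℝ) < n := by exact_mod_cast hn
  have hd' : (0:ℝ) < d := by exact_mod_cast hd
  have hm' : (0:ℝ) < (m:ℝ) + 1 := by positivity
  rw [div_sub_div _ _ hd'.ne' hm'.ne', div_le_div_iff₀ (by positivity) hn', ← Nat.cast_le (α := ℝ)]
  push_cast
  constructor <;> intro h <;> linarith

theorem DIM_le_Pi02 (U : List Bool →. List Bool)
    (hU : UniversalPF U) (α : ℝ) (num den : ℕ → ℕ) (hnum : Computable num) (hden : Computable den)
    (hpos : ∀ n, 0 < den n) (hlim : Tendsto (fun n => (num n : ℝ) / den n) atTop (𝓝 α)) :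
    PiIn 2 DeltaPred {X : Cantor | dimK U X ≤ α} := by
  obtain ⟨h, hh, hspec⟩ := exists_halt U hU.1.1
  -- the prefix length codes `(n, s, l, t)`
  let T : ℕ × List Bool × ℕ × ℕ × ℕ × ℕ → Bool := fun x =>
    (decide (x.1 < x.2.2.1) && decide (x.1 ≤ x.2.2.2.1)) &&
    (h (x.2.2.2.2.1, x.2.1.take x.2.2.1, x.2.2.2.2.2) &&
      decide (x.2.2.2.2.1 * (x.1 + 1) * den x.2.2.2.1 <
        (num x.2.2.2.1 * (x.1 + 1) + den x.2.2.2.1) * x.2.2.1))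
  have hT : Computable T := by
    have m : Computable fun x : ℕ × List Bool × ℕ × ℕ × ℕ × ℕ => x.1 := Computable.fst
    have r1 : Computable fun x : ℕ × List Bool × ℕ × ℕ × ℕ × ℕ => x.2 := Computable.snd
    have w : Computable fun x : ℕ × List Bool × ℕ × ℕ × ℕ × ℕ => x.2.1 := Computable.fst.comp r1
    have r2 : Computable fun x : ℕ × List Bool × ℕ × ℕ × ℕ × ℕ => x.2.2 := Computable.snd.comp r1
    have n : Computable fun x : ℕ × List Bool × ℕ × ℕ × ℕ × ℕ => x.2.2.1 := Computable.fst.comp r2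
    have r3 : Computable fun x : ℕ × List Bool × ℕ × ℕ × ℕ × ℕ => x.2.2.2 := Computable.snd.comp r2
    have s : Computable fun x : ℕ × List Bool × ℕ × ℕ × ℕ × ℕ => x.2.2.2.1 := Computable.fst.comp r3
    have r4 : Computable fun x : ℕ × List Bool × ℕ × ℕ × ℕ × ℕ => x.2.2.2.2 := Computable.snd.comp r3
    have l : Computable fun x : ℕ × List Bool × ℕ × ℕ × ℕ × ℕ => x.2.2.2.2.1 := Computable.fst.comp r4
    have t : Computable fun x : ℕ × List Bool × ℕ × ℕ × ℕ × ℕ => x.2.2.2.2.2 := Computable.snd.comp r4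
    have lt : Computable₂ fun a b : ℕ => decide (a < b) := Primrec.nat_lt.decide.to_comp
    have le : Computable₂ fun a b : ℕ => decide (a ≤ b) := Primrec.nat_le.decide.to_comp
    have mul : Computable₂ fun a b : ℕ => a * b := Primrec.nat_mul.to_comp
    have addc : Computable₂ fun a b : ℕ => a + b := Primrec.nat_add.to_comp
    have m1 := Computable.succ.comp m
    have and := Primrec.and.to_comp
    have tk := (Primrec.list_take (α := Bool)).to_comp
    exact and.comp (and.comp (lt.comp m n) (le.comp m s))
      (and.comp (hh.comp (l.pair ((tk.comp n w).pair t)))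
        (lt.comp (mul.comp (mul.comp l m1) (hden.comp s))
          (mul.comp (addc.comp (mul.comp (hnum.comp s) m1) (hden.comp s)) n)))
  let F : List ℕ × List Bool → Bool := fun x =>
    T (x.1.getD 0 0, x.2, x.2.length.unpair.1, x.2.length.unpair.2.unpair.1,
      x.2.length.unpair.2.unpair.2.unpair.1, x.2.length.unpair.2.unpair.2.unpair.2)
  have hF : Computable F := by
    have g0 : Primrec fun x : List ℕ × List Bool => x.1.getD 0 0 :=
      (Primrec.list_getD 0).comp Primrec.fst (Primrec.const 0)
    have u0 : Primrec fun x : List ℕ × List Bool => x.2.length.unpair :=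
      Primrec.unpair.comp (Primrec.list_length.comp Primrec.snd)
    have u1 : Primrec fun x : List ℕ × List Bool => x.2.length.unpair.2.unpair :=
      Primrec.unpair.comp (Primrec.snd.comp u0)
    have u2 : Primrec fun x : List ℕ × List Bool => x.2.length.unpair.2.unpair.2.unpair :=
      Primrec.unpair.comp (Primrec.snd.comp u1)
    exact hT.comp (g0.pair (Primrec.snd.pair ((Primrec.fst.comp u0).pair
      ((Primrec.fst.comp u1).pair ((Primrec.fst.comp u2).pair (Primrec.snd.comp u2)))))).to_comp
  refine ⟨fun ks w => F (ks, w) = true, DeltaPred_of F hF, fun X => ?_⟩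
  simp only [AltQ, List.nil_append, Set.mem_ofPred_eq]
  obtain ⟨C, hC⟩ := ratio_bound U hU X
  obtain ⟨c, hc⟩ := K_bound U hU
  rw [dimK, liminf_le_char (ratio_nonneg U X) hC hlim]
  refine forall_congr' fun m => ?_
  constructor
  · rintro ⟨n, s, hn, hs, hlt⟩
    obtain ⟨t, ht⟩ := (hspec _ _).1 (hc (pref X n)).1
    refine ⟨Nat.pair n (Nat.pair s (Nat.pair (K U (pref X n)) t)), ?_⟩
    rw [cmp_lt _ _ _ _ _ (by omega) (hpos s)] at hlt
    simp only [F, T, pref_length, Nat.unpair_pair, pref_take X (Nat.left_le_pair _ _), ht]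
    simp [hn, hs, hlt]
  · rintro ⟨k, hk⟩
    simp only [F, T, pref_length, pref_take X (Nat.unpair_left_le _)] at hk
    simp only [List.getD_cons_zero, Bool.and_eq_true, decide_eq_true_eq] at hk
    obtain ⟨⟨h1, h2⟩, h3, h4⟩ := hk
    obtain ⟨p, hp, hpl⟩ := (hspec _ _).2 ⟨_, h3⟩
    refine ⟨_, _, h1, h2, ?_⟩
    have hK := K_le U hp
    rw [← cmp_lt _ _ _ _ _ (by omega) (hpos _)] at h4
    refine lt_of_le_of_lt ?_ h4
    rw [← hpl]
    gcongr

theorem DIM_ge_Pi03 (U : List Bool →. List Bool)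
    (hU : UniversalPF U) (α : ℝ) (num den : ℕ → ℕ) (hnum : Computable num) (hden : Computable den)
    (hpos : ∀ n, 0 < den n) (hlim : Tendsto (fun n => (num n : ℝ) / den n) atTop (𝓝 α)) :
    PiIn 3 DeltaPred {X : Cantor | α ≤ dimK U X} := by
  obtain ⟨h, hh, hspec⟩ := exists_halt U hU.1.1
  let T : ℕ × ℕ × List Bool × ℕ × ℕ × ℕ × ℕ → Bool := fun x =>
    !((decide (x.2.1 < x.2.2.2.1) && decide (x.2.1 ≤ x.2.2.2.2.1)) &&
    (h (x.2.2.2.2.2.1, x.2.2.1.take x.2.2.2.1, x.2.2.2.2.2.2) &&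
      decide (x.2.2.2.2.2.1 * (x.1 + 1) * den x.2.2.2.2.1 + den x.2.2.2.2.1 * x.2.2.2.1 <
        num x.2.2.2.2.1 * (x.1 + 1) * x.2.2.2.1)))
  have hT : Computable T := by
    have m : Computable fun x : ℕ × ℕ × List Bool × ℕ × ℕ × ℕ × ℕ => x.1 := Computable.fst
    have r0 : Computable fun x : ℕ × ℕ × List Bool × ℕ × ℕ × ℕ × ℕ => x.2 := Computable.snd
    have N : Computable fun x : ℕ × ℕ × List Bool × ℕ × ℕ × ℕ × ℕ => x.2.1 := Computable.fst.comp r0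
    have r1 : Computable fun x : ℕ × ℕ × List Bool × ℕ × ℕ × ℕ × ℕ => x.2.2 := Computable.snd.comp r0
    have w : Computable fun x : ℕ × ℕ × List Bool × ℕ × ℕ × ℕ × ℕ => x.2.2.1 := Computable.fst.comp r1
    have r2 : Computable fun x : ℕ × ℕ × List Bool × ℕ × ℕ × ℕ × ℕ => x.2.2.2 := Computable.snd.comp r1
    have n : Computable fun x : ℕ × ℕ × List Bool × ℕ × ℕ × ℕ × ℕ => x.2.2.2.1 := Computable.fst.comp r2
    have r3 : Computable fun x : ℕ × ℕ × List Bool × ℕ × ℕ × ℕ × ℕ => x.2.2.2.2 := Computable.snd.comp r2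
    have s : Computable fun x : ℕ × ℕ × List Bool × ℕ × ℕ × ℕ × ℕ => x.2.2.2.2.1 := Computable.fst.comp r3
    have r4 : Computable fun x : ℕ × ℕ × List Bool × ℕ × ℕ × ℕ × ℕ => x.2.2.2.2.2 := Computable.snd.comp r3
    have l : Computable fun x : ℕ × ℕ × List Bool × ℕ × ℕ × ℕ × ℕ => x.2.2.2.2.2.1 := Computable.fst.comp r4
    have t : Computable fun x : ℕ × ℕ × List Bool × ℕ × ℕ × ℕ × ℕ => x.2.2.2.2.2.2 := Computable.snd.comp r4
    have lt : Computable₂ fun a b : ℕ => decide (a < b) := Primrec.nat_lt.decide.to_comp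
    have le : Computable₂ fun a b : ℕ => decide (a ≤ b) := Primrec.nat_le.decide.to_comp
    have mul : Computable₂ fun a b : ℕ => a * b := Primrec.nat_mul.to_comp
    have addc : Computable₂ fun a b : ℕ => a + b := Primrec.nat_add.to_comp
    have m1 := Computable.succ.comp m
    have and := Primrec.and.to_comp
    have tk := (Primrec.list_take (α := Bool)).to_comp
    exact Primrec.not.to_comp.comp (and.comp (and.comp (lt.comp N n) (le.comp N s))
      (and.comp (hh.comp (l.pair ((tk.comp n w).pair t)))
        (lt.comp (addc.comp (mul.comp (mul.comp l m1) (hden.comp s)) (mul.comp (hden.comp s) n))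
          (mul.comp (mul.comp (hnum.comp s) m1) n))))
  let F : List ℕ × List Bool → Bool := fun x =>
    T (x.1.getD 0 0, x.1.getD 1 0, x.2, x.2.length.unpair.1, x.2.length.unpair.2.unpair.1,
      x.2.length.unpair.2.unpair.2.unpair.1, x.2.length.unpair.2.unpair.2.unpair.2)
  have hF : Computable F := by
    have g0 : Primrec fun x : List ℕ × List Bool => x.1.getD 0 0 :=
      (Primrec.list_getD 0).comp Primrec.fst (Primrec.const 0)
    have g1 : Primrec fun x : List ℕ × List Bool => x.1.getD 1 0 :=
      (Primrec.list_getD 0).comp Primrec.fst (Primrec.const 1)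
    have u0 : Primrec fun x : List ℕ × List Bool => x.2.length.unpair :=
      Primrec.unpair.comp (Primrec.list_length.comp Primrec.snd)
    have u1 : Primrec fun x : List ℕ × List Bool => x.2.length.unpair.2.unpair :=
      Primrec.unpair.comp (Primrec.snd.comp u0)
    have u2 : Primrec fun x : List ℕ × List Bool => x.2.length.unpair.2.unpair.2.unpair :=
      Primrec.unpair.comp (Primrec.snd.comp u1)
    exact hT.comp (g0.pair (g1.pair (Primrec.snd.pair ((Primrec.fst.comp u0).pair
      ((Primrec.fst.comp u1).pair ((Primrec.fst.comp u2).pair (Primrec.snd.comp u2))))))).to_comp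
  refine ⟨fun ks w => F (ks, w) = true, DeltaPred_of F hF, fun X => ?_⟩
  simp only [AltQ, List.nil_append, List.cons_append, Set.mem_ofPred_eq]
  obtain ⟨C, hC⟩ := ratio_bound U hU X
  obtain ⟨c, hc⟩ := K_bound U hU
  rw [dimK, le_liminf_char (ratio_nonneg U X) hC hlim]
  refine forall_congr' fun m => exists_congr fun N => ?_
  constructor
  · intro H k
    by_contra hk
    simp only [F, T, pref_length, pref_take X (Nat.unpair_left_le _)] at hk
    simp only [List.getD_cons_zero, List.getD_cons_succ, Bool.not_eq_true, Bool.not_eq_false',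
      Bool.and_eq_true, decide_eq_true_eq] at hk
    obtain ⟨⟨h1, h2⟩, h3, h4⟩ := hk
    obtain ⟨p, hp, hpl⟩ := (hspec _ _).2 ⟨_, h3⟩
    have hK := K_le U hp
    refine absurd h4 (not_lt.2 ?_)
    rw [← cmp_le _ _ _ _ _ (by omega) (hpos _)]
    refine (H _ _ h1 h2).trans ?_
    rw [← hpl]
    gcongr
  · intro H n s hn hs
    obtain ⟨t, ht⟩ := (hspec _ _).1 (hc (pref X n)).1
    have hk := H (Nat.pair n (Nat.pair s (Nat.pair (K U (pref X n)) t)))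
    rw [cmp_le _ _ _ _ _ (by omega) (hpos s)]
    simp only [F, T, pref_length, Nat.unpair_pair, pref_take X (Nat.left_le_pair _ _), ht] at hk
    simpa [hn, hs] using hk

/-- For every Δ⁰₂-computable `α ∈ [0,1]` (given by a computable rational
approximation `a` converging to `α`): `{X | dim(X) ≤ α}` is a Π⁰₂ class,
`{X | dim(X) ≥ α}` is a Π⁰₃ class, hence `DIM^α = {X | dim(X) = α}` is a Π⁰₃
class, and `DIM^0` is a Π⁰₂ class. Here `dim(X) = liminf_n K(X↾n)/n`. -/
theorem DIM_le_Pi02_and_DIM_ge_Pi03 (U : List Bool →. List Bool)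
    (hU : UniversalPF U) (α : ℝ) (hα : α ∈ Set.Icc (0:ℝ) 1)
    (a : ℕ → ℚ) (ha : Computable a)
    (hlim : Filter.Tendsto (fun n => (a n : ℝ)) Filter.atTop (nhds α)) :
    PiIn 2 DeltaPred {X : Cantor | dimK U X ≤ α} ∧
    PiIn 3 DeltaPred {X : Cantor | α ≤ dimK U X} ∧
    PiIn 3 DeltaPred {X : Cantor | dimK U X = α} ∧
    PiIn 2 DeltaPred {X : Cantor | dimK U X = 0} := by
  obtain ⟨num, den, hnum, hden, hpos, hl⟩ := exists_num_den α hα.1 a ha hlim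
  have h1 := DIM_le_Pi02 U hU α num den hnum hden hpos hl
  have h2 := DIM_ge_Pi03 U hU α num den hnum hden hpos hl
  have h3 : PiIn 2 DeltaPred {X : Cantor | dimK U X ≤ 0} :=
    DIM_le_Pi02 U hU 0 (fun _ => 0) (fun _ => 1) (Computable.const 0) (Computable.const 1)
      (fun _ => Nat.one_pos) (by simp)
  refine ⟨h1, h2, ?_, ?_⟩
  · have e : {X : Cantor | dimK U X = α} = {X | dimK U X ≤ α} ∩ {X | α ≤ dimK U X} := by
      ext X; exact le_antisymm_iff
    rw [e]
    exact PiIn_inter h1 h2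
  · have e : {X : Cantor | dimK U X = 0} = {X | dimK U X ≤ 0} := by
      ext X
      obtain ⟨C, hC⟩ := ratio_bound U hU X
      have h0 : 0 ≤ dimK U X := by
        refine le_liminf_of_le
          (isBoundedUnder_of ⟨C, hC⟩ : IsBoundedUnder (· ≤ ·) atTop _).isCoboundedUnder_ge ?_
        exact Eventually.of_forall (ratio_nonneg U X)
      exact ⟨fun h => le_of_eq h, fun h => le_antisymm h h0⟩
    rw [e]
    exact h3
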